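/- Let G=(V,E) be a mixed graph and let A, B, S be pairwise disjoint subsets of V. Then there exists a p-active trail between a vertex of A and a vertex of B relative to S if and only if there exists a p-connecting path between a vertex of A and a vertex of B given S. -/

import Mathlib

open MeasureTheory ProbabilityTheory Filter

noncomputable section

namespace GraphicalTS

/-! ### Mixed graphs, paths and p-separation -/

/-- A mixed graph on vertex type `V`, with directed edges `dir a b` (i.e. `a → b`)
and (symmetric) undirected edges `undir a b` (i.e. `a — b`). -/
structure MixedGraph (V : Type*) where
  dir : V → V → Prop
  undir : V → V → Prop
  undir_symm : ∀ a b, undir a b → undir b a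

namespace MixedGraph

variable {V : Type*}

/-- Parents of a set `A`: vertices `v ∉ A` with `v → a` for some `a ∈ A`. -/
def pa (G : MixedGraph V) (A : Set V) : Set V := {v | ∃ a ∈ A, G.dir v a} \ A

/-- Neighbours of a set `A`: vertices `v ∉ A` with `v — a` for some `a ∈ A`. -/
def nb (G : MixedGraph V) (A : Set V) : Set V := {v | ∃ a ∈ A, G.undir v a} \ A

/-- Children of a set `A`: vertices `v ∉ A` with `a → v` for some `a ∈ A`. -/
def ch (G : MixedGraph V) (A : Set V) : Set V := {v | ∃ a ∈ A, G.dir a v} \ A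

/-- `b` is an ancestor of `a`: `b = a` or there is a directed path `b → ⋯ → a`. -/
def ancestor (G : MixedGraph V) (b a : V) : Prop := Relation.ReflTransGen G.dir b a

/-- The set of ancestors of elements of `A`. -/
def anc (G : MixedGraph V) (A : Set V) : Set V := {b | ∃ a ∈ A, G.ancestor b a}

end MixedGraph

/-- The orientation of an edge as traversed along a path: forward directed (tail at the
current vertex, arrowhead at the next), backward directed, or undirected. -/
inductive EdgeKind : Type
  | fwd | bwd | un

/-- A path between `a` and `b` in the mixed graph `G`: a sequence of `n` edges along
vertices `vert 0 = a, vert 1, …, vert n = b`; vertices and edges may repeat.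
(`vert` and `kind` are total functions on `ℕ`; only the values `vert 0,…,vert n` and
`kind 0,…,kind (n-1)` are constrained.) -/
structure MGPath {V : Type*} (G : MixedGraph V) (a b : V) where
  n : ℕ
  vert : ℕ → V
  kind : ℕ → EdgeKind
  src : vert 0 = a
  tgt : vert n = b
  valid : ∀ i, i < n →
    (kind i = EdgeKind.fwd → G.dir (vert i) (vert (i + 1))) ∧
    (kind i = EdgeKind.bwd → G.dir (vert (i + 1)) (vert i)) ∧
    (kind i = EdgeKind.un → G.undir (vert i) (vert (i + 1)))

namespace MGPath

variable {V : Type*} {G : MixedGraph V} {a b : V}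

/-- The intermediate vertex at position `j` (for `0 < j < n`) is a p-collider: the two
adjacent edges form `→ c ←`, `→ c —` or `— c ←`. -/
def colliderAt (p : MGPath G a b) (j : ℕ) : Prop :=
  p.kind (j - 1) ≠ EdgeKind.bwd ∧ p.kind j ≠ EdgeKind.fwd ∧
    ¬(p.kind (j - 1) = EdgeKind.un ∧ p.kind j = EdgeKind.un)

/-- The path is p-connecting given `S`: every intermediate p-noncollider is outside `S`
and every intermediate p-collider is in `S`. -/
def pConnecting (p : MGPath G a b) (S : Set V) : Prop :=
  ∀ j, 0 < j → j < p.n →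
    (p.colliderAt j → p.vert j ∈ S) ∧ (¬p.colliderAt j → p.vert j ∉ S)

/-- The path has an arrowhead at its endpoint `b`. -/
def bPointing (p : MGPath G a b) : Prop :=
  0 < p.n ∧ p.kind (p.n - 1) = EdgeKind.fwd

/-- The path has arrowheads at both endpoints. -/
def biPointing (p : MGPath G a b) : Prop :=
  0 < p.n ∧ p.kind 0 = EdgeKind.bwd ∧ p.kind (p.n - 1) = EdgeKind.fwd

/-- The path consists of undirected edges only. -/
def undirected (p : MGPath G a b) : Prop := ∀ i, i < p.n → p.kind i = EdgeKind.un

/-- The path is a composition of finitely many subpaths, each of which is undirected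
or bi-pointing (cut points `c 0 = 0 < c 1 < ⋯ < c m = n`). -/
def extBiPointing (p : MGPath G a b) : Prop :=
  ∃ (m : ℕ) (c : ℕ → ℕ), c 0 = 0 ∧ c m = p.n ∧ (∀ k, k < m → c k < c (k + 1)) ∧
    ∀ k, k < m →
      (∀ i, c k ≤ i → i < c (k + 1) → p.kind i = EdgeKind.un) ∨
      (p.kind (c k) = EdgeKind.bwd ∧ p.kind (c (k + 1) - 1) = EdgeKind.fwd)

/-- Every intermediate vertex on the path is a p-collider. -/
def pureCollider (p : MGPath G a b) : Prop := ∀ j, 0 < j → j < p.n → p.colliderAt j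

/-- The path is a trail: all intermediate vertices are distinct. -/
def isTrail (p : MGPath G a b) : Prop :=
  ∀ i j, 0 < i → i < p.n → 0 < j → j < p.n → p.vert i = p.vert j → i = j

/-- The trail is p-active relative to `S` (Andersson–Madigan–Perlman): every p-collider
lies in `an(S)`, and every p-noncollider `v` either lies outside `S`, or its two adjacent
edges are undirected and `pa(v) ∖ S ≠ ∅`. -/
def pActive (p : MGPath G a b) (S : Set V) : Prop :=
  ∀ j, 0 < j → j < p.n →
    (p.colliderAt j → p.vert j ∈ G.anc S) ∧
    (¬p.colliderAt j →
      p.vert j ∉ S ∨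
        (p.kind (j - 1) = EdgeKind.un ∧ p.kind j = EdgeKind.un ∧
          ({v | G.dir v (p.vert j)} \ S).Nonempty))

end MGPath

/-- `A` and `B` are p-separated given `S`: every path between a vertex of `A` and a
vertex of `B` is p-blocked given `S`. -/
def pSeparated {V : Type*} (G : MixedGraph V) (A B S : Set V) : Prop :=
  ∀ a ∈ A, ∀ b ∈ B, ∀ p : MGPath G a b, ¬p.pConnecting S

/-- `a` and `b` are joined in `G` by an undirected path none of whose intermediate
vertices lies in `an(W) ∖ {a, b}`. -/
def undirAvoiding {V : Type*} (G : MixedGraph V) (W : Set V) (a b : V) : Prop :=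
  ∃ p : MGPath G a b, 0 < p.n ∧ p.undirected ∧
    ∀ j, 0 < j → j < p.n → p.vert j ∉ G.anc W \ {a, b}

/-- The marginal ancestral graph `G_[A]` (for an ancestral set `A`): the subgraph of `G`
induced by `A`, together with an additional undirected edge `a — b` for each pair
`a, b ∈ A` joined in `G` by an undirected path avoiding `an(A) ∖ {a, b}`. -/
def marginalGraph {V : Type*} (G : MixedGraph V) (A : Set V) : MixedGraph V where
  dir u v := G.dir u v ∧ u ∈ A ∧ v ∈ A
  undir u v := (G.undir u v ∧ u ∈ A ∧ v ∈ A) ∨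
    (u ∈ A ∧ v ∈ A ∧ (undirAvoiding G A u v ∨ undirAvoiding G A v u))
  undir_symm := by
    rintro x y (⟨h, hx, hy⟩ | ⟨hx, hy, h⟩)
    · exact Or.inl ⟨G.undir_symm _ _ h, hy, hx⟩
    · exact Or.inr ⟨hy, hx, h.symm⟩

/-! ### σ-algebras, conditional independence, Granger causality -/

variable {Ω : Type*}

/-- The `μ`-completion of a sub-σ-algebra `m`: the σ-algebra generated by `m` together
with all `μ`-null sets. -/
def mComplete [MeasurableSpace Ω] (μ : Measure Ω) (m : MeasurableSpace Ω) :
    MeasurableSpace Ω :=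
  m ⊔ MeasurableSpace.generateFrom {s : Set Ω | μ s = 0}

/-- `ℱ_A(t)`: the `μ`-completed σ-algebra generated by `{X_a(s) : a ∈ A, s ≤ t}`. -/
def pastSigma {V : Type*} [MeasurableSpace Ω] (μ : Measure Ω) (X : V → ℤ → Ω → ℝ)
    (A : Set V) (t : ℤ) : MeasurableSpace Ω :=
  mComplete μ (⨆ a ∈ A, ⨆ s ≤ t, MeasurableSpace.comap (X a s) inferInstance)

/-- Conditional independence `m₁ ⟂ m₂ | m₃` of sub-σ-algebras:
`E[1_G | m₂ ∨ m₃] = E[1_G | m₃]` a.s. for every `G ∈ m₁`. -/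
def CondIndepSigma [MeasurableSpace Ω] (μ : Measure Ω) (m₁ m₂ m₃ : MeasurableSpace Ω) :
    Prop :=
  ∀ s : Set Ω, MeasurableSet[m₁] s →
    μ[s.indicator fun _ => (1 : ℝ) | m₂ ⊔ m₃] =ᵐ[μ] μ[s.indicator fun _ => (1 : ℝ) | m₃]

/-- `X_A` is (strongly) Granger-noncausal for `X_B` with respect to `ℱ_S`
(`X_A ⇸ X_B [ℱ_S]`): `ℱ_B(t+1) ⟂ ℱ_A(t) | ℱ_{S∖A}(t)` for all `t`. -/
def GrangerNoncausal {V : Type*} [MeasurableSpace Ω] (μ : Measure Ω)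
    (X : V → ℤ → Ω → ℝ) (A B S : Set V) : Prop :=
  ∀ t : ℤ, CondIndepSigma μ (pastSigma μ X B (t + 1)) (pastSigma μ X A t)
    (pastSigma μ X (S \ A) t)

/-- `X_A` and `X_B` are contemporaneously conditionally independent with respect to
`ℱ_S` (`X_A ≁ X_B [ℱ_S]`): `ℱ_A(t+1) ⟂ ℱ_B(t+1) | ℱ_S(t) ∨ ℱ_{S∖(A∪B)}(t+1)`. -/
def ContempIndep {V : Type*} [MeasurableSpace Ω] (μ : Measure Ω)
    (X : V → ℤ → Ω → ℝ) (A B S : Set V) : Prop :=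
  ∀ t : ℤ, CondIndepSigma μ (pastSigma μ X A (t + 1)) (pastSigma μ X B (t + 1))
    (pastSigma μ X S t ⊔ pastSigma μ X (S \ (A ∪ B)) (t + 1))

/-! ### Granger-causal Markov properties (ground set `W`, usually `W = Set.univ`) -/

/-- (PC) the pairwise Granger-causal Markov property w.r.t. `G` (on ground set `W`). -/
def PairwiseMarkov {V : Type*} [MeasurableSpace Ω] (μ : Measure Ω)
    (X : V → ℤ → Ω → ℝ) (G : MixedGraph V) (W : Set V) : Prop :=
  ∀ a ∈ W, ∀ b ∈ W, a ≠ b →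
    (¬G.dir a b → GrangerNoncausal μ X {a} {b} W) ∧
    (¬G.undir a b → ContempIndep μ X {a} {b} W)

/-- (LC) the local Granger-causal Markov property w.r.t. `G` (on ground set `W`). -/
def LocalMarkov {V : Type*} [MeasurableSpace Ω] (μ : Measure Ω)
    (X : V → ℤ → Ω → ℝ) (G : MixedGraph V) (W : Set V) : Prop :=
  ∀ a ∈ W,
    GrangerNoncausal μ X (W \ (G.pa {a} ∪ {a})) {a} W ∧
    ContempIndep μ X (W \ (G.nb {a} ∪ {a})) {a} W

/-- (BC) the block-recursive Granger-causal Markov property w.r.t. `G`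
(on ground set `W`). -/
def BlockRecursiveMarkov {V : Type*} [MeasurableSpace Ω] (μ : Measure Ω)
    (X : V → ℤ → Ω → ℝ) (G : MixedGraph V) (W : Set V) : Prop :=
  ∀ A ⊆ W,
    GrangerNoncausal μ X (W \ (G.pa A ∪ A)) A W ∧
    ContempIndep μ X (W \ (G.nb A ∪ A)) A W

/-- (GC) the global Granger-causal Markov property w.r.t. `G`. -/
def GlobalMarkov {V : Type*} [MeasurableSpace Ω] (μ : Measure Ω)
    (X : V → ℤ → Ω → ℝ) (G : MixedGraph V) : Prop :=
  ∀ A B S : Set V, Disjoint A B → Disjoint A S → Disjoint B S →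
    ((∀ a ∈ A, ∀ b ∈ B, ∀ p : MGPath G a b, p.bPointing → ¬p.pConnecting (S ∪ B)) →
      GrangerNoncausal μ X A B (A ∪ B ∪ S)) ∧
    ((∀ a ∈ A, ∀ b ∈ B, ∀ p : MGPath G a b, p.extBiPointing →
        ¬p.pConnecting (A ∪ B ∪ S)) →
      ContempIndep μ X A B (A ∪ B ∪ S))

/-! ### Conditions (M) and (P) -/

/-- Stationarity: the joint law of `(X_V(t+s))_{s∈ℤ}` does not depend on `t`. -/
def Stationary {V : Type*} [MeasurableSpace Ω] (μ : Measure Ω)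
    (X : V → ℤ → Ω → ℝ) : Prop :=
  ∀ t : ℤ,
    Measure.map (fun ω => fun q : ℤ × V => X q.2 (t + q.1) ω) μ =
    Measure.map (fun ω => fun q : ℤ × V => X q.2 q.1 ω) μ

/-- Strong mixing: `sup |P(S₁ ∩ S₂) − P(S₁) P(S₂)| → 0` as `k → ∞`, the supremum being
over `S₁ ∈ σ(X_V(s) : s ≤ t)` and `S₂ ∈ σ(X_V(s) : s ≥ t + k)`. -/
def StrongMixing {V : Type*} [MeasurableSpace Ω] (μ : Measure Ω)
    (X : V → ℤ → Ω → ℝ) : Prop :=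
  ∀ t : ℤ, ∀ ε > (0 : ℝ), ∃ K : ℕ, ∀ k : ℕ, K ≤ k → ∀ S₁ S₂ : Set Ω,
    MeasurableSet[⨆ (v : V), ⨆ s ≤ t, MeasurableSpace.comap (X v s) inferInstance] S₁ →
    MeasurableSet[⨆ (v : V), ⨆ (s : ℤ) (_ : t + k ≤ s),
      MeasurableSpace.comap (X v s) inferInstance] S₂ →
    |(μ (S₁ ∩ S₂)).toReal - (μ S₁).toReal * (μ S₂).toReal| ≤ ε

/-- Condition (M): the process is stationary and strongly mixing. -/
def ConditionM {V : Type*} [MeasurableSpace Ω] (μ : Measure Ω)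
    (X : V → ℤ → Ω → ℝ) : Prop :=
  Stationary μ X ∧ StrongMixing μ X

/-- `ν` is a product measure on `ℝ^V`. -/
def IsProductMeasure {V : Type*} [Fintype V] (ν : Measure (V → ℝ)) : Prop :=
  ∃ νv : V → Measure ℝ, ∀ B : V → Set ℝ, (∀ v, MeasurableSet (B v)) →
    ν (Set.univ.pi B) = ∏ v, νv v (B v)

/-- The past trajectory `(X_V(s))_{s ≤ t}` of the process at time `t`. -/
def pastTraj {V : Type*} (X : V → ℤ → Ω → ℝ) (t : ℤ) (ω : Ω) : ℤ → V → ℝ :=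
  fun s v => if s ≤ t then X v s ω else 0

/-- Condition (P): the conditional distribution of `X_V(t+1)` given the past
`(X_V(s))_{s≤t}` has a regular version (a Markov kernel `κ` applied to the past
trajectory) that is almost surely absolutely continuous with respect to some product
measure `ν` on `ℝ^V` with a `ν`-a.e. positive and continuous density `f`. -/
def ConditionP {V : Type*} [Fintype V] [MeasurableSpace Ω] (μ : Measure Ω)
    (X : V → ℤ → Ω → ℝ) : Prop :=
  ∃ ν : Measure (V → ℝ), IsProductMeasure ν ∧
    ∀ t : ℤ, ∃ (κ : Kernel (ℤ → V → ℝ) (V → ℝ)) (f : (ℤ → V → ℝ) → (V → ℝ) → ℝ),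
      IsMarkovKernel κ ∧
      (∀ B : Set (V → ℝ), MeasurableSet B →
        (μ[fun ω => B.indicator (fun _ => (1 : ℝ)) (fun v => X v (t + 1) ω) |
            pastSigma μ X Set.univ t]) =ᵐ[μ]
          fun ω => (κ (pastTraj X t ω) B).toReal) ∧
      (∀ᵐ ω ∂μ,
        κ (pastTraj X t ω) =
          ν.withDensity (fun y => ENNReal.ofReal (f (pastTraj X t ω) y)) ∧
        (∀ᵐ y ∂ν, 0 < f (pastTraj X t ω) y ∧ ContinuousAt (f (pastTraj X t ω)) y))


namespace MGPath

variable {V : Type*} {G : MixedGraph V} {a b : V} {S : Set V}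

/-- The path `p` followed by one further edge of kind `k` to the vertex `w`. -/
def snoc (p : MGPath G a b) (k : EdgeKind) (w : V)
    (hfwd : k = EdgeKind.fwd → G.dir b w) (hbwd : k = EdgeKind.bwd → G.dir w b)
    (hun : k = EdgeKind.un → G.undir b w) : MGPath G a w where
  n := p.n + 1
  vert i := if i ≤ p.n then p.vert i else w
  kind i := if i < p.n then p.kind i else k
  src := by simp [p.src]
  tgt := by simp
  valid i hi := by
    rcases Nat.lt_succ_iff_lt_or_eq.mp hi with h | rfl
    · simpa [h, h.le, Nat.succ_le_iff] using p.valid i h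
    · simpa [p.tgt] using ⟨hfwd, hbwd, hun⟩

/-- The path `p` with the closed subpath between the positions `i` and `j` removed. -/
def excise (p : MGPath G a b) (i j : ℕ) (hij : i < j) (hj : j < p.n)
    (hv : p.vert i = p.vert j) : MGPath G a b where
  n := p.n - (j - i)
  vert m := if m ≤ i then p.vert m else p.vert (m + (j - i))
  kind m := if m < i then p.kind m else p.kind (m + (j - i))
  src := by simp [p.src]
  tgt := by
    rw [if_neg (by omega), Nat.sub_add_cancel (by omega), p.tgt]
  valid m hm := by
    rcases lt_trichotomy m i with h | rfl | h
    · simpa [h, h.le, Nat.succ_le_iff] using p.valid m (by omega)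
    · have h' := p.valid j hj
      have e₁ : m + (j - m) = j := by omega
      have e₂ : m + 1 + (j - m) = j + 1 := by omega
      simpa [e₁, e₂, hv] using h'
    · have h' := p.valid (m + (j - i)) (by omega)
      have e : m + 1 + (j - i) = m + (j - i) + 1 := by omega
      simpa [show ¬m < i by omega, show ¬m ≤ i by omega, show ¬m + 1 ≤ i by omega, e] using h'

/-- There is a nonempty p-connecting path from `a` to `v` whose last edge has kind `k`. -/
def Reaches (G : MixedGraph V) (S : Set V) (a v : V) (k : EdgeKind) : Prop :=
  ∃ p : MGPath G a v, 0 < p.n ∧ p.kind (p.n - 1) = k ∧ p.pConnecting S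

lemma pConnecting_snoc (p : MGPath G a b) {k : EdgeKind} {w : V} (hfwd hbwd hun)
    (hp : p.pConnecting S)
    (hb : 0 < p.n →
      ((p.kind (p.n - 1) ≠ EdgeKind.bwd ∧ k ≠ EdgeKind.fwd ∧
        ¬(p.kind (p.n - 1) = EdgeKind.un ∧ k = EdgeKind.un)) ↔ b ∈ S)) :
    (p.snoc k w hfwd hbwd hun).pConnecting S := by
  intro j hj0 hj
  rcases Nat.lt_succ_iff_lt_or_eq.mp hj with h | rfl
  · have := hp j hj0 h
    simpa [colliderAt, snoc, h, h.le, show j - 1 < p.n by omega] using this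
  · have := hb hj0
    simp only [colliderAt, snoc, show p.n - 1 < p.n by omega, if_true, lt_irrefl, if_false,
      le_refl, p.tgt]
    tauto

lemma Reaches.step {v w : V} {k : EdgeKind} (h : Reaches G S a v k) (k' : EdgeKind)
    (hfwd : k' = EdgeKind.fwd → G.dir v w) (hbwd : k' = EdgeKind.bwd → G.dir w v)
    (hun : k' = EdgeKind.un → G.undir v w)
    (hv : (k ≠ EdgeKind.bwd ∧ k' ≠ EdgeKind.fwd ∧
      ¬(k = EdgeKind.un ∧ k' = EdgeKind.un)) ↔ v ∈ S) :
    Reaches G S a w k' := by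
  obtain ⟨p, -, rfl, hp⟩ := h
  exact ⟨p.snoc k' w hfwd hbwd hun, by simp [snoc], by simp [snoc],
    p.pConnecting_snoc hfwd hbwd hun hp fun _ => hv⟩

/-- A detour along a directed path to `S` and back. -/
lemma Reaches.detour {v s : V} (hs : s ∈ S) (hvs : G.ancestor v s) {k : EdgeKind}
    (hk : k ≠ EdgeKind.bwd) (hv : v ∉ S) (h : Reaches G S a v k) :
    Reaches G S a v EdgeKind.bwd := by
  induction hvs using Relation.ReflTransGen.head_induction_on generalizing k with
  | refl => exact absurd hs hv
  | @head v d hvd _ ih =>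
    have hd : Reaches G S a d EdgeKind.fwd :=
      h.step EdgeKind.fwd (fun _ => hvd) (by simp) (by simp) (by simp [hv])
    by_cases hdS : d ∈ S
    · exact hd.step EdgeKind.bwd (by simp) (fun _ => hvd) (by simp) (by simp [hdS])
    · exact (ih (by simp) hdS hd).step EdgeKind.bwd (by simp) (fun _ => hvd) (by simp)
        (by simp [hdS])

/-- Each edge of a p-active path can be appended to a p-connecting path, after a detour. -/
lemma reaches_of_pActive (p : MGPath G a b) (hp : p.pActive S) (j : ℕ) (hj : j < p.n) :
    Reaches G S a (p.vert (j + 1)) (p.kind j) := by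
  induction j with
  | zero =>
    have h := p.valid 0 hj
    rw [p.src] at h
    let q : MGPath G a a := ⟨0, fun _ => a, fun _ => EdgeKind.un, rfl, rfl, by simp⟩
    exact ⟨q.snoc (p.kind 0) (p.vert 1) h.1 h.2.1 h.2.2, by simp [snoc], by simp [snoc, q],
      q.pConnecting_snoc h.1 h.2.1 h.2.2 (fun i _ hi => absurd hi (by simp [q])) (by simp [q])⟩
  | succ j ih =>
    have hr := ih (by omega)
    obtain ⟨h₁, h₂, h₃⟩ := p.valid (j + 1) hj
    obtain ⟨hc, hn⟩ := hp (j + 1) (by omega) hj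
    simp only [colliderAt, Nat.add_sub_cancel] at hc hn
    by_cases hcol : p.kind j ≠ EdgeKind.bwd ∧ p.kind (j + 1) ≠ EdgeKind.fwd ∧
        ¬(p.kind j = EdgeKind.un ∧ p.kind (j + 1) = EdgeKind.un)
    · by_cases hS : p.vert (j + 1) ∈ S
      · exact hr.step _ h₁ h₂ h₃ (iff_of_true hcol hS)
      · obtain ⟨s, hs, hanc⟩ := hc hcol
        exact (hr.detour hs hanc hcol.1 hS).step _ h₁ h₂ h₃ (by simp [hS])
    · by_cases hS : p.vert (j + 1) ∈ S
      · obtain ⟨hu, hu', u, hdir, huS⟩ := (hn hcol).resolve_left (not_not.mpr hS)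
        rw [hu] at hr
        have hub : Reaches G S a u EdgeKind.bwd :=
          hr.step EdgeKind.bwd (by simp) (fun _ => hdir) (by simp) (by simp [hS])
        have hvf : Reaches G S a (p.vert (j + 1)) EdgeKind.fwd :=
          hub.step EdgeKind.fwd (fun _ => hdir) (by simp) (by simp) (by simp [huS])
        exact hvf.step _ h₁ h₂ h₃ (by simp [hS, hu'])
      · exact hr.step _ h₁ h₂ h₃ (iff_of_false hcol hS)

lemma exists_pConnecting_of_pActive (p : MGPath G a b) (hp : p.pActive S) :
    ∃ q : MGPath G a b, q.pConnecting S := by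
  rcases Nat.eq_zero_or_pos p.n with h | h
  · exact ⟨p, fun j _ hj => absurd hj (by omega)⟩
  · have := reaches_of_pActive p hp (p.n - 1) (by omega)
    rw [Nat.sub_add_cancel h, p.tgt] at this
    obtain ⟨q, -, -, hq⟩ := this
    exact ⟨q, hq⟩

lemma pConnecting.pActive {p : MGPath G a b} (hp : p.pConnecting S) : p.pActive S :=
  fun j hj0 hj => ⟨fun hc => ⟨_, (hp j hj0 hj).1 hc, Relation.ReflTransGen.refl⟩,
    fun hc => Or.inl ((hp j hj0 hj).2 hc)⟩

/-- A p-active path leaving a vertex outside `an(S)` by a forward edge stays directed. -/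
lemma pActive.kind_eq_fwd {p : MGPath G a b} (hp : p.pActive S) {i : ℕ}
    (hk : p.kind i = EdgeKind.fwd) (hv : p.vert i ∉ G.anc S) {m : ℕ} (him : i ≤ m)
    (hm : m < p.n) : p.kind m = EdgeKind.fwd := by
  suffices h : p.kind m = EdgeKind.fwd ∧ G.ancestor (p.vert i) (p.vert m) from h.1
  induction m, him using Nat.le_induction with
  | base => exact ⟨hk, Relation.ReflTransGen.refl⟩
  | succ m him ih =>
    obtain ⟨hf, hanc⟩ := ih (by omega)
    have hanc' : G.ancestor (p.vert i) (p.vert (m + 1)) :=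
      hanc.tail ((p.valid m (by omega)).1 hf)
    refine ⟨?_, hanc'⟩
    by_contra hne
    obtain ⟨s, hs, hms⟩ := (hp (m + 1) (by omega) hm).1 (by simp [colliderAt, hf, hne])
    exact hv ⟨s, hs, hanc'.trans hms⟩

/-- A p-active path entering a vertex outside `an(S)` by a backward edge was directed. -/
lemma pActive.kind_eq_bwd {p : MGPath G a b} (hp : p.pActive S) {j : ℕ} (hj : j < p.n)
    (hk : p.kind j = EdgeKind.bwd) (hv : p.vert (j + 1) ∉ G.anc S) {m : ℕ} (hmj : m ≤ j) :
    p.kind m = EdgeKind.bwd := by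
  suffices h : p.kind m = EdgeKind.bwd ∧ G.ancestor (p.vert (j + 1)) (p.vert m) from h.1
  induction hmj using Nat.decreasingInduction with
  | self => exact ⟨hk, .single ((p.valid j hj).2.1 hk)⟩
  | of_succ m hm ih =>
    obtain ⟨hf, hanc⟩ := ih
    have hb : p.kind m = EdgeKind.bwd := by
      by_contra hne
      obtain ⟨s, hs, hms⟩ := (hp (m + 1) (by omega) (by omega)).1 (by simp [colliderAt, hf, hne])
      exact hv ⟨s, hs, hanc.trans hms⟩
    exact ⟨hb, hanc.tail ((p.valid m (by omega)).2.1 hb)⟩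

lemma pActive.excise {p : MGPath G a b} (hp : p.pActive S) {i j : ℕ} (hi : 0 < i)
    (hij : i < j) (hj : j < p.n) (hv : p.vert i = p.vert j) :
    (p.excise i j hij hj hv).pActive S := by
  intro m hm0 hm
  simp only [MGPath.excise] at hm
  rcases lt_trichotomy m i with h | rfl | h
  · simpa [colliderAt, MGPath.excise, h, h.le, show m - 1 < i by omega] using
      hp m hm0 (by omega)
  · obtain ⟨hci, hni⟩ := hp m hm0 (by omega)
    obtain ⟨hcj, hnj⟩ := hp j (by omega) hj
    rw [← hv] at hcj hnj
    simp only [colliderAt, MGPath.excise, show m - 1 < m by omega, show m + (j - m) = j by omega,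
      if_true, lt_irrefl, if_false, le_refl]
    constructor
    · rintro ⟨h₁, h₂, h₃⟩
      by_contra hanc
      have hni' := mt hci hanc
      have hnj' := mt hcj hanc
      have hcase : p.kind (m - 1) = EdgeKind.fwd ∨ p.kind j = EdgeKind.bwd := by
        cases hk : p.kind (m - 1) <;> cases hk' : p.kind j <;> simp_all
      rcases hcase with hk | hk
      · have hf : p.kind m = EdgeKind.fwd := by
          by_contra hne
          exact hni' ⟨h₁, hne, by simp [hk]⟩
        exact h₂ (hp.kind_eq_fwd hf hanc hij.le hj)
      · have hb : p.kind (j - 1) = EdgeKind.bwd := by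
          by_contra hne
          exact hnj' ⟨hne, h₂, by simp [hk]⟩
        refine h₁ (hp.kind_eq_bwd (j := j - 1) (by omega) hb ?_ (by omega))
        rwa [Nat.sub_add_cancel (by omega), ← hv]
    · intro hnc
      by_cases hS : p.vert m ∈ S
      swap
      · exact Or.inl hS
      have hni' : ¬p.colliderAt m → p.kind (m - 1) = EdgeKind.un ∧ p.kind m = EdgeKind.un ∧
          ({v | G.dir v (p.vert m)} \ S).Nonempty := fun h => (hni h).resolve_left (not_not.mpr hS)
      have hnj' : ¬p.colliderAt j → p.kind (j - 1) = EdgeKind.un ∧ p.kind j = EdgeKind.un ∧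
          ({v | G.dir v (p.vert m)} \ S).Nonempty := fun h => (hnj h).resolve_left (not_not.mpr hS)
      have h₁ : p.kind (m - 1) ≠ EdgeKind.bwd := fun hk => by
        have := hni' (fun h => h.1 hk)
        simp [hk] at this
      have h₂ : p.kind j ≠ EdgeKind.fwd := fun hk => by
        have := hnj' (fun h => h.2.1 hk)
        simp [hk] at this
      have h₃ : p.kind (m - 1) = EdgeKind.un ∧ p.kind j = EdgeKind.un := by tauto
      refine Or.inr ⟨h₃.1, h₃.2, ?_⟩
      by_cases hcm : p.colliderAt m
      swap
      · exact (hni' hcm).2.2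
      by_cases hcj' : p.colliderAt j
      swap
      · exact (hnj' hcj').2.2
      have hb : p.kind m = EdgeKind.bwd := by
        obtain ⟨-, hx, hy⟩ := hcm
        cases hk : p.kind m <;> simp_all
      have hlt : m + 1 < j := by
        rcases Nat.lt_or_eq_of_le (Nat.succ_le_of_lt hij) with h | rfl
        · exact h
        · exact absurd hb hcj'.1
      refine ⟨p.vert (m + 1), (p.valid m (by omega)).2.1 hb, ?_⟩
      rcases (hp (m + 1) (by omega) (by omega)).2 (fun h => h.1 hb) with h | h
      · exact h
      · simp [hb] at h
  · have := hp (m + (j - i)) (by omega) (by omega)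
    simpa [colliderAt, MGPath.excise, show ¬m < i by omega, show ¬m ≤ i by omega,
      show ¬m - 1 < i by omega, show m - 1 + (j - i) = m + (j - i) - 1 by omega] using this

lemma exists_isTrail_of_pActive (p : MGPath G a b) (hp : p.pActive S) :
    ∃ q : MGPath G a b, q.isTrail ∧ q.pActive S := by
  induction hn : p.n using Nat.strong_induction_on generalizing p with
  | _ n ih =>
    by_cases ht : p.isTrail
    · exact ⟨p, ht, hp⟩
    · have : ∃ i j, 0 < i ∧ i < j ∧ j < p.n ∧ p.vert i = p.vert j := by
        simp only [isTrail, not_forall] at ht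
        obtain ⟨i, j, hi0, hi, hj0, hj, hv, hne⟩ := ht
        rcases Nat.lt_or_gt_of_ne hne with h | h
        · exact ⟨i, j, hi0, h, hj, hv⟩
        · exact ⟨j, i, hj0, h, hi, hv.symm⟩
      obtain ⟨i, j, hi0, hij, hj, hv⟩ := this
      exact ih _ (by simp only [MGPath.excise]; omega) (p.excise i j hij hj hv)
        (hp.excise hi0 hij hj hv) rfl

end MGPath

/-- Proposition: equivalence of the two notions of p-separation.
For a mixed graph `G` and pairwise disjoint `A, B, S ⊆ V`: there is a p-active trail
between a vertex of `A` and a vertex of `B` relative to `S` iff there is a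
p-connecting path between a vertex of `A` and a vertex of `B` given `S`. -/
theorem pActive_trail_iff_pConnecting_path
    {V : Type*} (G : MixedGraph V) (A B S : Set V)
    (hAB : Disjoint A B) (hAS : Disjoint A S) (hBS : Disjoint B S) :
    (∃ a ∈ A, ∃ b ∈ B, ∃ p : MGPath G a b, p.isTrail ∧ p.pActive S) ↔
    (∃ a ∈ A, ∃ b ∈ B, ∃ p : MGPath G a b, p.pConnecting S) := by
  constructor
  · rintro ⟨a, ha, b, hb, p, -, hp⟩
    exact ⟨a, ha, b, hb, p.exists_pConnecting_of_pActive hp⟩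
  · rintro ⟨a, ha, b, hb, p, hp⟩
    exact ⟨a, ha, b, hb, p.exists_isTrail_of_pActive hp.pActive⟩

end GraphicalTS
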